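/- arXiv:1503.09025 — 8 statements merged into one kernel-verified Lean document; each statement's English description precedes it below -/
import Mathlib

section
/- A Boolean function f : {0,1}^n → Bool admits a Horn CNF representation if and only if the set of assignments satisfying f is closed under pointwise meet (bitwise intersection). -/
open scoped Classical

/-- Assignments over `n` propositional variables: elements of `{0,1}^n`. -/
abbrev Asg (n : ℕ) := Fin n → Bool

/-- `ones x` is the set of variables set to `true` in the assignment `x`. -/
def ones {n : ℕ} (x : Asg n) : Finset (Fin n) :=
  Finset.univ.filter (fun i => x i = true)

/-- `bits α` is the assignment whose true variables are exactly `α`. -/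
def bits {n : ℕ} (α : Finset (Fin n)) : Asg n := fun i => decide (i ∈ α)

/-- An implication `α → β`, given as the pair of antecedent and consequent variable sets. -/
abbrev Imp (n : ℕ) := Finset (Fin n) × Finset (Fin n)

/-- The assignment `x` satisfies the implication `p = (α, β)` iff
`α ⊆ ones x` implies `β ⊆ ones x`. -/
def SatImp {n : ℕ} (x : Asg n) (p : Imp n) : Prop :=
  p.1 ⊆ ones x → p.2 ⊆ ones x

/-- A CNF in implicational form: a finite set of implications. -/
abbrev CNF (n : ℕ) := Finset (Imp n)

/-- `x` satisfies the CNF `H` iff it satisfies every implication in it. -/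
def SatCNF {n : ℕ} (x : Asg n) (H : CNF n) : Prop := ∀ p ∈ H, SatImp x p

/-- A CNF is definite Horn when every consequent is nonempty. -/
def IsDefinite {n : ℕ} (H : CNF n) : Prop := ∀ p ∈ H, p.2.Nonempty

/-- `H` represents the Boolean function `f`. -/
def Represents {n : ℕ} (H : CNF n) (f : Asg n → Bool) : Prop :=
  ∀ x, f x = true ↔ SatCNF x H

/-- A Boolean function is definite Horn if some definite Horn CNF represents it. -/
def DefiniteHorn {n : ℕ} (f : Asg n → Bool) : Prop :=
  ∃ H : CNF n, IsDefinite H ∧ Represents H f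

/-- The closure `x*` of `x` with respect to `f`: the pointwise meet of all
assignments `y` with `x ≤ y` that satisfy `f`. -/
noncomputable def closureFn {n : ℕ} (f : Asg n → Bool) (x : Asg n) : Asg n :=
  fun i => decide (∀ y : Asg n, x ≤ y → f y = true → y i = true)

/-- The closure of `x` with respect to (the function represented by) the CNF `H`:
the pointwise meet of all assignments `y ≥ x` satisfying `H`. -/
noncomputable def closureCNF {n : ℕ} (H : CNF n) (x : Asg n) : Asg n :=
  fun i => decide (∀ y : Asg n, x ≤ y → SatCNF y H → y i = true)

/-- `f` entails the implication `α → β`. -/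
def Entails {n : ℕ} (f : Asg n → Bool) (α β : Finset (Fin n)) : Prop :=
  ∀ x, f x = true → SatImp x (α, β)

/-- A clause with at most one positive literal (a Horn clause): the set of
negated variables together with an optional positive literal. -/
abbrev HornClause (n : ℕ) := Finset (Fin n) × Option (Fin n)

/-- `x` satisfies a Horn clause iff it falsifies some negated variable or
makes the positive literal (if any) true. -/
def SatClause {n : ℕ} (x : Asg n) (c : HornClause n) : Prop :=
  (∃ i ∈ c.1, x i = false) ∨ (∃ b : Fin n, c.2 = some b ∧ x b = true)

/-- A Boolean function admits a Horn CNF representation iff its set of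
satisfying assignments is closed under pointwise meet. -/
theorem stmt_0 {n : ℕ} (f : Asg n → Bool) :
    (∃ C : Finset (HornClause n), ∀ x : Asg n,
        f x = true ↔ ∀ c ∈ C, SatClause x c) ↔
    (∀ x y : Asg n, f x = true → f y = true → f (x ⊓ y) = true) := by
  constructor
  · rintro ⟨C, hC⟩ x y hx hy
    rw [hC] at hx hy ⊢
    intro c hc
    have h1 := hx c hc
    have h2 := hy c hc
    unfold SatClause at h1 h2 ⊢
    rcases h1 with ⟨i, hi, h⟩ | ⟨b, hb, h⟩
    · exact Or.inl ⟨i, hi, by simp [h]⟩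
    · rcases h2 with ⟨i, hi, h'⟩ | ⟨b', hb', h'⟩
      · exact Or.inl ⟨i, hi, by simp [h']⟩
      · have hbb : b = b' := Option.some.inj (hb.symm.trans hb')
        subst hbb
        exact Or.inr ⟨b, hb, by simp [h, h']⟩
  · intro hf
    refine ⟨Finset.univ.filter (fun c => ∀ y : Asg n, f y = true → SatClause y c), fun x => ?_⟩
    constructor
    · intro hx c hc
      exact (Finset.mem_filter.mp hc).2 x hx
    · intro h
      -- a clause with antecedent `ones x` that `x` falsifies is not entailed by `f`
      have key : ∀ o : Option (Fin n), (∀ b, o = some b → x b = false) →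
          ∃ y : Asg n, f y = true ∧ x ≤ y ∧ ∀ b, o = some b → y b = false := by
        intro o ho
        by_contra hcon
        have hx := h (ones x, o) (by
          refine Finset.mem_filter.mpr ⟨Finset.mem_univ _, fun y hy => ?_⟩
          by_contra hns
          apply hcon
          unfold SatClause at hns
          push Not at hns
          refine ⟨y, hy, ?_, fun b hb => by simpa using hns.2 b hb⟩
          intro i
          cases hxi : x i with
          | false => exact Bool.false_le _
          | true =>
            have := hns.1 i (by simp [ones, hxi])
            simp at this
            simp [this])
        rcases hx with ⟨i, hi, h'⟩ | ⟨b, hb, h'⟩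
        · simp [ones, h'] at hi
        · have := ho b hb
          simp [this] at h'
      obtain ⟨y0, hy0, hxy0, -⟩ := key none (by simp)
      let S : Finset (Asg n) := Finset.univ.filter (fun y => f y = true ∧ x ≤ y)
      have hS : S.Nonempty := ⟨y0, by simp [S, hy0, hxy0]⟩
      have hz : f (S.inf' hS id) = true :=
        Finset.inf'_induction (p := fun y => f y = true) hS id
          (fun a ha b hb => hf a b ha hb)
          (fun y hy => (Finset.mem_filter.mp hy).2.1)
      have hle : x ≤ S.inf' hS id :=
        Finset.le_inf' _ _ (fun y hy => (Finset.mem_filter.mp hy).2.2)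
      have hge : S.inf' hS id ≤ x := by
        intro b
        cases hxb : x b with
        | true => exact Bool.le_true _
        | false =>
          obtain ⟨y, hy, hxy, hyb⟩ := key (some b) (by
            intro b' hb'
            cases hb'
            exact hxb)
          have hmem : y ∈ S := by simp [S, hy, hxy]
          have := (Finset.inf'_le (f := id) (s := S) hmem) b
          exact this.trans (le_of_eq (hyb b rfl))
      rw [le_antisymm hle hge]
      exact hz
end

section
/- Let H be a definite Horn CNF and let y_i, y_j be assignments such that there exists an assignment z satisfying H with y_i ∧ y_j ≤ z ≤ y_j. Then no implication α → β belonging to H is falsified by both y_i and y_j. -/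
open scoped Classical

/-- If some assignment `z` satisfying `H` lies between `yi ⊓ yj` and `yj`,
then no implication of `H` is falsified by both `yi` and `yj`. -/
theorem stmt_7 {n : ℕ} (H : CNF n) (hH : IsDefinite H) (yi yj : Asg n)
    (hz : ∃ z : Asg n, SatCNF z H ∧ yi ⊓ yj ≤ z ∧ z ≤ yj) :
    ∀ p ∈ H, ¬(¬ SatImp yi p ∧ ¬ SatImp yj p) := by
  rintro p hp ⟨h1, h2⟩
  obtain ⟨z, hzH, hle, hzj⟩ := hz
  unfold SatImp at h1 h2
  push Not at h1 h2
  obtain ⟨a1, _⟩ := h1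
  obtain ⟨a2, b2⟩ := h2
  apply b2
  have hz1 : p.1 ⊆ ones z := by
    intro v hv
    have e1 := a1 hv
    have e2 := a2 hv
    simp only [ones, Finset.mem_filter, Finset.mem_univ, true_and] at e1 e2 ⊢
    have h := hle v
    simp only [Pi.inf_apply, e1, e2] at h
    exact h rfl
  intro v hv
  have e := hzH p hp hz1 hv
  simp only [ones, Finset.mem_filter, Finset.mem_univ, true_and] at e ⊢
  exact hzj v e
end

section
/- Let H be a definite Horn CNF with m implications, and let y_1, ..., y_k be assignments such that each y_i does not satisfy H, and for every pair i < j there exists an assignment z satisfying H with y_i ∧ y_j ≤ z ≤ y_j. Then k ≤ m. -/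
open scoped Classical

/-- If `y 1, …, y k` all falsify the definite Horn CNF `H` (of `m` implications)
and for every `i < j` some assignment `z` satisfying `H` lies between
`y i ⊓ y j` and `y j`, then `k ≤ m`. -/
theorem stmt_8 {n m k : ℕ} (H : CNF n) (hH : IsDefinite H) (hm : H.card = m)
    (y : Fin k → Asg n)
    (hneg : ∀ i : Fin k, ¬ SatCNF (y i) H)
    (hz : ∀ i j : Fin k, i < j →
      ∃ z : Asg n, SatCNF z H ∧ y i ⊓ y j ≤ z ∧ z ≤ y j) :
    k ≤ m := by
  have h1 : ∀ i, ∃ p ∈ H, p.1 ⊆ ones (y i) ∧ ¬ p.2 ⊆ ones (y i) := by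
    intro i
    have h := hneg i
    unfold SatCNF SatImp at h
    push Not at h
    exact h
  choose p hpH hp1 hp2 using h1
  have key : ∀ i j : Fin k, i < j → p i ≠ p j := by
    intro i j hij he
    obtain ⟨z, hzH, hle, hzy⟩ := hz i j hij
    apply hp2 j
    have hb : (p j).2 ⊆ ones z := by
      apply hzH _ (hpH j)
      intro v hv
      have hi := hp1 i (he ▸ hv)
      have hj := hp1 j hv
      have hl := hle v
      simp only [ones, Finset.mem_filter, Finset.mem_univ, true_and, Pi.inf_apply] at *
      rw [hi, hj] at hl
      exact top_le_iff.mp (by simpa using hl)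
    intro v hv
    have hv' := hb hv
    have hl := hzy v
    simp only [ones, Finset.mem_filter, Finset.mem_univ, true_and] at *
    rw [hv'] at hl
    exact top_le_iff.mp hl
  have hinj : Function.Injective p := by
    intro i j he
    rcases lt_trichotomy i j with h | h | h
    · exact absurd he (key i j h)
    · exact h
    · exact absurd he.symm (key j i h)
  have hc := Finset.card_le_card_of_injOn (s := Finset.univ) (t := H) p
    (fun i _ => hpH i) hinj.injOn
  rw [← hm]
  simpa using hc
end

section
/- Let T be a definite Horn function and let y_1, ..., y_k be assignments such that each y_i does not satisfy T, and for every pair i < j there exists an assignment z satisfying T with y_i ∧ y_j ≤ z ≤ y_j. Then for all i ≠ j, the assignment y_i satisfies the implication ones(y_j) → ones(y_j*), where y_j* is the closure of y_j with respect to T; equivalently, if y_j ≤ y_i then y_j* ≤ y_i. -/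
open scoped Classical

/-- Under the invariant of the learning algorithm, each counterexample `y i`
satisfies the implication `ones (y j) → ones (y j)*` generated by any other
counterexample `y j`; equivalently, `y j ≤ y i` implies `(y j)* ≤ y i`. -/
theorem stmt_9 {n k : ℕ} (T : Asg n → Bool) (hT : DefiniteHorn T)
    (y : Fin k → Asg n)
    (hneg : ∀ i : Fin k, T (y i) = false)
    (hz : ∀ i j : Fin k, i < j →
      ∃ z : Asg n, T z = true ∧ y i ⊓ y j ≤ z ∧ z ≤ y j) :
    ∀ i j : Fin k, i ≠ j →
      SatImp (y i) (ones (y j), ones (closureFn T (y j))) ∧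
      (y j ≤ y i → closureFn T (y j) ≤ y i) := by
  intro i j hij
  have key : y j ≤ y i → closureFn T (y j) ≤ y i := by
    intro hle
    rcases lt_or_gt_of_ne hij with h | h
    · obtain ⟨z, hTz, h1, h2⟩ := hz i j h
      rw [inf_eq_right.mpr hle] at h1
      have hzy : z = y j := le_antisymm h2 h1
      rw [hzy, hneg j] at hTz
      exact absurd hTz (by simp)
    · obtain ⟨z, hTz, h1, h2⟩ := hz j i h
      rw [inf_eq_left.mpr hle] at h1
      refine le_trans ?_ h2
      intro v hv
      simp only [closureFn, decide_eq_true_eq] at hv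
      exact hv z h1 hTz
  refine ⟨?_, key⟩
  intro hsub
  have hle : y j ≤ y i := by
    intro v hv
    have hm : v ∈ ones (y j) := by simpa [ones] using hv
    simpa [ones] using hsub hm
  intro v hv
  have hv' : closureFn T (y j) v = true := by simpa [ones] using hv
  have := key hle v hv'
  simpa [ones] using this
end

section
/- Let T and H be definite Horn functions over n variables, α a set of variables and b a variable, such that T entails the implication α → {b} but H does not. Let w be the closure of bits(α) with respect to H. Then w satisfies H, w falsifies the implication α → {b} (in particular α ⊆ ones(w) and b ∉ ones(w)), and w does not satisfy T. -/
open scoped Classical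

/-- From a positive counterexample clause to a negative counterexample
assignment: if `T ⊨ α → {b}` but `H ⊭ α → {b}`, then the closure `w` of
`bits α` with respect to `H` satisfies `H`, falsifies `α → {b}` (with
`α ⊆ ones w` and `b ∉ ones w`), and does not satisfy `T`. -/
theorem stmt_16 {n : ℕ} (T H : Asg n → Bool)
    (hT : DefiniteHorn T) (hH : DefiniteHorn H)
    (α : Finset (Fin n)) (b : Fin n)
    (hTe : Entails T α {b}) (hHe : ¬ Entails H α {b})
    (w : Asg n) (hw : w = closureFn H (bits α)) :
    H w = true ∧ ¬ SatImp w (α, ({b} : Finset (Fin n))) ∧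
    α ⊆ ones w ∧ b ∉ ones w ∧ T w = false := by
  have hone : ∀ (x : Asg n) (i : Fin n), i ∈ ones x ↔ x i = true := by
    intro x i; simp [ones]
  have hle : ∀ y : Asg n, bits α ≤ y ↔ α ⊆ ones y := by
    intro y
    constructor
    · intro h i hi
      rw [hone]
      have h1 := h i
      have h2 : bits α i = true := by simp [bits, hi]
      rw [h2] at h1
      exact Bool.eq_true_of_true_le h1
    · intro h i
      by_cases hi : i ∈ α
      · rw [(hone y i).1 (h hi)]
        exact Bool.le_true _
      · have h2 : bits α i = false := by simp [bits, hi]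
        rw [h2]
        exact Bool.false_le _
  have hwi : ∀ i, i ∈ ones w ↔ ∀ y : Asg n, α ⊆ ones y → H y = true → i ∈ ones y := by
    intro i
    rw [hone, hw]
    simp only [closureFn, decide_eq_true_eq, hle, hone]
  have hα : α ⊆ ones w := fun i hi => (hwi i).2 fun y hy _ => hy hi
  have hb : b ∉ ones w := by
    intro hbw
    apply hHe
    intro x hx hxα
    exact Finset.singleton_subset_iff.2 ((hwi b).1 hbw x hxα hx)
  have hns : ¬ SatImp w (α, ({b} : Finset (Fin n))) := fun h =>
    hb (Finset.singleton_subset_iff.1 (h hα))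
  refine ⟨?_, hns, hα, hb, ?_⟩
  · obtain ⟨C, _, hC⟩ := hH
    rw [hC]
    intro p hp hpw i hi
    rw [hwi]
    intro y hy hHy
    exact (hC y).1 hHy p hp (fun j hj => (hwi j).1 (hpw hj) y hy hHy) hi
  · rw [← Bool.not_eq_true]
    exact fun h => hns (hTe w h)
end

section
/- Let T and H be definite Horn functions and x an assignment that satisfies H but does not satisfy T. Then x < x*, where x* is the closure of x with respect to T, and for every variable v ∈ ones(x*) \ ones(x): T entails the implication ones(x) → {v} while H does not entail it. -/
open scoped Classical

/-- From a negative counterexample assignment to a counterexample clause: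
if `x` satisfies `H` but not `T`, then `x < x*` (closure with respect to `T`),
and each variable `v ∈ ones x* \ ones x` yields a clause `ones x → {v}`
entailed by `T` but not by `H`. -/
theorem stmt_17 {n : ℕ} (T H : Asg n → Bool)
    (hT : DefiniteHorn T) (hH : DefiniteHorn H)
    (x : Asg n) (hxH : H x = true) (hxT : T x = false) :
    x < closureFn T x ∧
    ∀ v ∈ ones (closureFn T x) \ ones x,
      Entails T (ones x) {v} ∧ ¬ Entails H (ones x) {v} := by
  have le_iff : ∀ y : Asg n, x ≤ y ↔ ones x ⊆ ones y := by
    intro y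
    constructor
    · intro h i hi
      simp only [ones, Finset.mem_filter, Finset.mem_univ, true_and] at hi ⊢
      have := h i
      rw [hi] at this
      exact top_le_iff.1 this
    · intro h i
      cases hxi : x i with
      | false => exact Bool.false_le _
      | true =>
        have : i ∈ ones y := h (by simp [ones, hxi])
        simp only [ones, Finset.mem_filter, Finset.mem_univ, true_and] at this
        simp [this]
  refine ⟨?_, ?_⟩
  · obtain ⟨C, -, hC⟩ := hT
    have hle : x ≤ closureFn T x := by
      rw [le_iff]
      intro i hi
      simp only [ones, closureFn, Finset.mem_filter, Finset.mem_univ, true_and,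
        decide_eq_true_eq]
      intro y hy _
      have := (le_iff y).1 hy hi
      simpa [ones] using this
    refine lt_of_le_of_ne hle ?_
    intro heq
    have hx : T x = true := by
      rw [hC]
      intro p hp hp1 v hv
      rw [heq]
      simp only [ones, closureFn, Finset.mem_filter, Finset.mem_univ, true_and,
        decide_eq_true_eq]
      intro y hy hTy
      have := (hC y).1 hTy p hp (hp1.trans ((le_iff y).1 hy)) hv
      simpa [ones] using this
    rw [hx] at hxT
    exact Bool.noConfusion hxT
  · intro v hv
    rw [Finset.mem_sdiff] at hv
    obtain ⟨hv1, hv2⟩ := hv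
    refine ⟨?_, ?_⟩
    · intro y hTy hy
      simp only [ones, closureFn, Finset.mem_filter, Finset.mem_univ, true_and,
        decide_eq_true_eq] at hv1
      have := hv1 y ((le_iff y).2 hy) hTy
      simpa [ones] using this
    · intro h
      exact hv2 (h x hxH (Finset.Subset.refl _) (Finset.mem_singleton_self v))
end

section
/- For every assignment x over n variables with x ≠ 1^n, the set of assignments satisfying the definite Horn CNF f_x is exactly {x, 1^n}, and the closure of the all-false assignment 0^n with respect to f_x equals x. -/
open scoped Classical

/-- The hard family member `f_x`: for each variable `v ∈ ones x` the
implication `∅ → {v}`, and for each `w ∉ ones x` the implication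
`{w} → V` where `V` is the set of all variables. -/
def fX {n : ℕ} (x : Asg n) : CNF n :=
  ((ones x).image fun v => ((∅ : Finset (Fin n)), ({v} : Finset (Fin n)))) ∪
  (((ones x)ᶜ).image fun w => (({w} : Finset (Fin n)), (Finset.univ : Finset (Fin n))))

/-- The CNF `f_x` is satisfied exactly by `x` and the all-true assignment, and
the closure of the all-false assignment with respect to `f_x` is `x`. -/
theorem stmt_18 {n : ℕ} (x : Asg n) (hx : x ≠ fun _ => true) :
    (∀ z : Asg n, SatCNF z (fX x) ↔ (z = x ∨ z = fun _ => true)) ∧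
    closureCNF (fX x) (fun _ => false) = x := by
  have key : ∀ z : Asg n, SatCNF z (fX x) ↔
      ((∀ v, x v = true → z v = true) ∧
        (∀ w, x w = false → z w = true → ∀ i, z i = true)) := by
    intro z
    constructor
    · intro h
      constructor
      · intro v hv
        have h1 := h (∅, {v}) (by
          unfold fX
          refine Finset.mem_union_left _ (Finset.mem_image.2 ⟨v, ?_, rfl⟩)
          simp [ones, hv])
        have h2 := h1 (Finset.empty_subset _)
        simpa [ones] using h2
      · intro w hw hz i
        have h1 := h ({w}, Finset.univ) (by
          unfold fX
          refine Finset.mem_union_right _ (Finset.mem_image.2 ⟨w, ?_, rfl⟩)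
          simp [ones, hw])
        have h2 := h1 (by simp [ones, hz]) (Finset.mem_univ i)
        simpa [ones] using h2
    · rintro ⟨h1, h2⟩ p hp
      unfold fX at hp
      rcases Finset.mem_union.1 hp with hp | hp
      · obtain ⟨v, hv, rfl⟩ := Finset.mem_image.1 hp
        intro _
        have hv' : x v = true := by simpa [ones] using hv
        simp [ones, h1 v hv']
      · obtain ⟨w, hw, rfl⟩ := Finset.mem_image.1 hp
        intro hs
        have hw' : x w = false := by simpa [ones] using hw
        have hz : z w = true := by simpa [ones] using hs
        intro i _
        simp [ones, h2 w hw' hz i]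
  have main : ∀ z : Asg n, SatCNF z (fX x) ↔ (z = x ∨ z = fun _ => true) := by
    intro z
    rw [key]
    constructor
    · rintro ⟨h1, h2⟩
      by_cases h : ∃ w, x w = false ∧ z w = true
      · obtain ⟨w, hw, hz⟩ := h
        exact Or.inr (funext (h2 w hw hz))
      · left
        funext i
        cases hxi : x i
        · cases hzi : z i
          · rfl
          · exact absurd ⟨i, hxi, hzi⟩ h
        · exact h1 i hxi
    · rintro (rfl | rfl)
      · refine ⟨fun _ h => h, fun w h h' => ?_⟩
        rw [h] at h'
        cases h'
      · exact ⟨fun _ _ => rfl, fun _ _ _ _ => rfl⟩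
  refine ⟨main, ?_⟩
  funext i
  unfold closureCNF
  cases hxi : x i
  · refine decide_eq_false fun h => ?_
    have := h x (fun _ => Bool.false_le _) ((main x).2 (Or.inl rfl))
    rw [hxi] at this
    cases this
  · refine decide_eq_true fun y _ hy => ?_
    rcases (main y).1 hy with rfl | rfl
    · exact hxi
    · rfl
end

section
/- Let n ≥ 2 and let Q be any finite set of assignments over n variables with |Q| ≤ 2^n − 3. Then there exist distinct assignments x and y, neither equal to 1^n and neither belonging to Q, such that every q ∈ Q satisfies f_x if and only if q satisfies f_y, while the closure of 0^n with respect to f_x (namely x) differs from the closure of 0^n with respect to f_y (namely y). Hence fewer than 2^n − 2 standard membership queries cannot in general determine the answer to a closure query. -/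
open scoped Classical

theorem sat_fX {n : ℕ} (q x : Asg n) :
    SatCNF q (fX x) ↔ q = x ∨ q = (fun _ => true) := by
  constructor
  · intro h
    by_cases hw : ∃ w, q w = true ∧ x w = false
    · right
      obtain ⟨w, hq, hx⟩ := hw
      have h1 := h ({w}, Finset.univ) (by
        unfold fX
        refine Finset.mem_union_right _ (Finset.mem_image.2 ⟨w, ?_, rfl⟩)
        simp [ones, hx])
      have h2 := h1 (by simp [ones, hq])
      funext i
      have h3 := h2 (Finset.mem_univ i)
      simpa [ones] using h3
    · left
      funext i
      cases hx : x i
      · cases hq : q i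
        · rfl
        · exact absurd ⟨i, hq, hx⟩ hw
      · have h1 := h (∅, {i}) (by
          unfold fX
          refine Finset.mem_union_left _ (Finset.mem_image.2 ⟨i, ?_, rfl⟩)
          simp [ones, hx])
        have h2 := h1 (by simp)
        simpa [ones] using h2
  · rintro (rfl | rfl) p hp
    · unfold fX at hp
      rcases Finset.mem_union.1 hp with hp | hp
      · obtain ⟨v, hv, rfl⟩ := Finset.mem_image.1 hp
        intro _
        simpa using hv
      · obtain ⟨v, hv, rfl⟩ := Finset.mem_image.1 hp
        intro h
        exact absurd (Finset.singleton_subset_iff.1 h) (Finset.mem_compl.1 hv)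
    · intro _ i _
      simp [ones]

theorem closure_fX {n : ℕ} (x : Asg n) : closureCNF (fX x) (fun _ => false) = x := by
  funext i
  unfold closureCNF
  rw [Bool.eq_iff_iff, decide_eq_true_iff]
  constructor
  · intro h
    exact h x (fun _ => Bool.false_le _) ((sat_fX x x).2 (Or.inl rfl))
  · intro h y _ hy
    rcases (sat_fX y x).1 hy with rfl | rfl
    · exact h
    · rfl

/-- Lower bound adversary: given at most `2^n - 3` membership queries `Q`,
there are two distinct non-top assignments `x, y` outside `Q` whose theories
`f_x` and `f_y` answer all queries in `Q` identically, yet whose closures of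
the all-false assignment (namely `x` and `y`) differ. Hence fewer than
`2^n - 2` standard membership queries cannot determine a closure query. -/
theorem stmt_19 {n : ℕ} (hn : 2 ≤ n) (Q : Finset (Asg n))
    (hQ : Q.card ≤ 2 ^ n - 3) :
    ∃ x y : Asg n, x ≠ y ∧ x ≠ (fun _ => true) ∧ y ≠ (fun _ => true) ∧
      x ∉ Q ∧ y ∉ Q ∧
      (∀ q ∈ Q, (SatCNF q (fX x) ↔ SatCNF q (fX y))) ∧
      closureCNF (fX x) (fun _ => false) ≠ closureCNF (fX y) (fun _ => false) := by
  have hc : (insert (fun _ => true) Q : Finset (Asg n)).card ≤ Q.card + 1 :=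
    Finset.card_insert_le _ _
  have h4 : 2 ^ 2 ≤ 2 ^ n := Nat.pow_le_pow_right (by norm_num) hn
  have hu : Fintype.card (Asg n) = 2 ^ n := by simp
  have hcompl := Finset.card_compl (insert (fun _ => true) Q : Finset (Asg n))
  have h1 : 1 < ((insert (fun _ => true) Q : Finset (Asg n))ᶜ).card := by
    rw [hcompl, hu]
    omega
  obtain ⟨x, hx, y, hy, hxy⟩ := Finset.one_lt_card.1 h1
  simp only [Finset.mem_compl, Finset.mem_insert, not_or] at hx hy
  refine ⟨x, y, hxy, hx.1, hy.1, hx.2, hy.2, ?_, ?_⟩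
  · intro q hq
    rw [sat_fX, sat_fX]
    have h5 : q ≠ x := fun h => hx.2 (h ▸ hq)
    have h6 : q ≠ y := fun h => hy.2 (h ▸ hq)
    simp [h5, h6]
  · rwa [closure_fX, closure_fX]
end
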